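/- arXiv:1302.1186 — 2 statements merged into one kernel-verified Lean document; each statement's English description precedes it below -/
import Mathlib

section
/- Let G be a finite group acting transitively on a finite set Ω with point stabilizer H, and let m_H be the minimum multiplicity of a nontrivial irreducible component of the permutation representation 1_H^G. Let S ⊆ G with characteristic function χ_S, let ℓ_S = max{|g₁Hg₂ ∩ S| : g₁, g₂ ∈ G}, and let f: Ω → ℝ satisfy Σ_ω f(ω) = 0. Then ‖χ_S ∗ f‖ ≤ √(ℓ_S|Ω|/m_H) · ‖χ_S‖ · ‖f‖. -/
open scoped BigOperators

/-- The convolution of a function on a finite group `G` with a function on a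
`G`-set `Ω`: `(X ∗ Y)(ω) = ∑_{g ∈ G} X(g) Y(g⁻¹ • ω)`. -/
noncomputable def convAct {G : Type*} [Group G] [Fintype G] {Ω : Type*} [MulAction G Ω]
    (X : G → ℝ) (Y : Ω → ℝ) : Ω → ℝ :=
  fun ω => ∑ g : G, X g * Y (g⁻¹ • ω)

/-- The Euclidean norm of a function on a finite set. -/
noncomputable def norm2 {Ω : Type*} [Fintype Ω] (f : Ω → ℝ) : ℝ :=
  Real.sqrt (∑ ω : Ω, f ω ^ 2)

/-- A subspace of `ℝ^Ω` invariant under the permutation action of `G`. -/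
def PermInvariant (G : Type*) [Group G] {Ω : Type*} [MulAction G Ω]
    (p : Submodule ℝ (Ω → ℝ)) : Prop :=
  ∀ (g : G) (f : Ω → ℝ), f ∈ p → (fun ω => f (g⁻¹ • ω)) ∈ p

/-- A nontrivial irreducible component of the permutation representation of `G` on `ℝ^Ω`. -/
def IsNontrivIrredComponent (G : Type*) [Group G] {Ω : Type*} [MulAction G Ω]
    (p : Submodule ℝ (Ω → ℝ)) : Prop :=
  PermInvariant G p ∧ p ≠ ⊥ ∧
    (∀ q : Submodule ℝ (Ω → ℝ), q ≤ p → PermInvariant G q → q = ⊥ ∨ q = p) ∧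
    (∃ (g : G) (f : Ω → ℝ), f ∈ p ∧ (fun ω => f (g⁻¹ • ω)) ≠ f)

/-- The space of `G`-equivariant linear maps from a subspace `p ≤ ℝ^Ω` to `ℝ^Ω`;
its dimension is the multiplicity of the component `p` in the permutation
representation. -/
noncomputable def equivHom (G : Type*) [Group G] {Ω : Type*} [MulAction G Ω] [Fintype Ω]
    (p : Submodule ℝ (Ω → ℝ)) : Submodule ℝ ((↥p) →ₗ[ℝ] (Ω → ℝ)) where
  carrier := {φ | ∀ (g : G) (x y : ↥p),
      ((y : Ω → ℝ) = fun ω => (x : Ω → ℝ) (g⁻¹ • ω)) → ∀ ω, φ y ω = φ x (g⁻¹ • ω)}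
  add_mem' := by
    intro φ ψ hφ hψ g x y h ω
    simp only [LinearMap.add_apply, Pi.add_apply, hφ g x y h ω, hψ g x y h ω]
  zero_mem' := by
    intro g x y h ω
    simp
  smul_mem' := by
    intro c φ hφ g x y h ω
    simp only [LinearMap.smul_apply, Pi.smul_apply, hφ g x y h ω]


open Module

/-- The permutation action of `g` on `ℝ^Ω`, as a linear isometry. -/
noncomputable def permIsometry {G : Type*} [Group G] (Ω : Type*) [Fintype Ω] [MulAction G Ω]
    (g : G) : EuclideanSpace ℝ Ω ≃ₗᵢ[ℝ] EuclideanSpace ℝ Ω :=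
  LinearIsometryEquiv.piLpCongrLeft 2 ℝ ℝ (MulAction.toPerm g)

section

variable {G : Type*} [Group G] {Ω : Type*} [Fintype Ω] [MulAction G Ω]

@[simp]
lemma permIsometry_apply (g : G) (x : EuclideanSpace ℝ Ω) (ω : Ω) :
    permIsometry Ω g x ω = x (g⁻¹ • ω) := rfl

lemma inner_permIsometry (g : G) (x y : EuclideanSpace ℝ Ω) :
    inner ℝ (permIsometry Ω g x) y = inner ℝ x (permIsometry Ω g⁻¹ y) := by
  rw [← (permIsometry Ω g).inner_map_map x]
  congr 1
  ext ω
  simp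

lemma permIsometry_mul (g h : G) (x : EuclideanSpace ℝ Ω) :
    permIsometry Ω (g * h) x = permIsometry Ω g (permIsometry Ω h x) := by
  ext ω
  simp [mul_smul]

lemma permIsometry_mem_orthogonal {p : Submodule ℝ (EuclideanSpace ℝ Ω)}
    (hp : ∀ (g : G), ∀ x ∈ p, permIsometry Ω g x ∈ p) (g : G) {x : EuclideanSpace ℝ Ω}
    (hx : x ∈ pᗮ) : permIsometry Ω g x ∈ pᗮ := by
  intro y hy
  rw [real_inner_comm, inner_permIsometry, real_inner_comm]
  exact hx _ (hp _ _ hy)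

lemma starProjection_permIsometry {p : Submodule ℝ (EuclideanSpace ℝ Ω)}
    (hp : ∀ (g : G), ∀ x ∈ p, permIsometry Ω g x ∈ p) (g : G) (x : EuclideanSpace ℝ Ω) :
    p.starProjection (permIsometry Ω g x) = permIsometry Ω g (p.starProjection x) := by
  refine Submodule.eq_starProjection_of_mem_orthogonal
    (hp g _ (p.starProjection_apply_mem x)) ?_
  rw [← map_sub]
  exact permIsometry_mem_orthogonal hp g (p.sub_starProjection_mem_orthogonal x)

lemma exists_minimal_invariant_le {W : Submodule ℝ (EuclideanSpace ℝ Ω)} (hW : W ≠ ⊥)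
    (hinv : ∀ (g : G), ∀ x ∈ W, permIsometry Ω g x ∈ W) :
    ∃ p ≤ W, p ≠ ⊥ ∧ (∀ (g : G), ∀ x ∈ p, permIsometry Ω g x ∈ p) ∧
      ∀ q ≤ p, (∀ (g : G), ∀ x ∈ q, permIsometry Ω g x ∈ q) → q = ⊥ ∨ q = p := by
  obtain ⟨p, ⟨hpW, hp0, hp⟩, hmin⟩ := wellFounded_lt.has_min
    {q : Submodule ℝ (EuclideanSpace ℝ Ω) | q ≤ W ∧ q ≠ ⊥ ∧
      ∀ (g : G), ∀ x ∈ q, permIsometry Ω g x ∈ q} ⟨W, le_rfl, hW, hinv⟩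
  refine ⟨p, hpW, hp0, hp, fun q hqp hq => ?_⟩
  by_contra! h
  exact hmin q ⟨hqp.trans hpW, h.1, hq⟩ (lt_of_le_of_ne hqp h.2)

lemma eq_zero_of_forall_permIsometry_eq [MulAction.IsPretransitive G Ω]
    {x : EuclideanSpace ℝ Ω} (hx : ∀ g : G, permIsometry Ω g x = x) (hsum : ∑ ω, x ω = 0) :
    x = 0 := by
  ext ω
  have h : ∀ ω', x ω' = x ω := by
    intro ω'
    obtain ⟨g, rfl⟩ := MulAction.exists_smul_eq G ω' ω
    conv_rhs => rw [← hx g]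
    simp
  simp only [h, Finset.sum_const, Finset.card_univ, nsmul_eq_mul, mul_eq_zero] at hsum
  have : Nonempty Ω := ⟨ω⟩
  simpa using hsum

lemma sum_permIsometry (g : G) (x : EuclideanSpace ℝ Ω) :
    ∑ ω, permIsometry Ω g x ω = ∑ ω, x ω :=
  Equiv.sum_comp (MulAction.toPerm g⁻¹) (fun ω => x ω)

/-- The vectors of `ℝ^Ω` whose coordinates sum to zero. -/
noncomputable def sumZero (Ω : Type*) [Fintype Ω] : Submodule ℝ (EuclideanSpace ℝ Ω) where
  carrier := {x | ∑ ω, x ω = 0}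
  add_mem' {x y} hx hy := by
    simp only [Set.mem_ofPred_eq] at hx hy
    simp [Finset.sum_add_distrib, hx, hy]
  zero_mem' := by simp
  smul_mem' c x hx := by
    simp only [Set.mem_ofPred_eq] at hx
    simp [← Finset.mul_sum, hx]

@[simp]
lemma mem_sumZero {x : EuclideanSpace ℝ Ω} : x ∈ sumZero Ω ↔ ∑ ω, x ω = 0 := Iff.rfl

lemma permIsometry_mem_sumZero (g : G) {x : EuclideanSpace ℝ Ω} (hx : x ∈ sumZero Ω) :
    permIsometry Ω g x ∈ sumZero Ω :=
  (sum_permIsometry g x).trans hx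

/-- A nonzero vector orthogonal to the constants generates, under the commutant of the
permutation action, a space whose dimension is at least some nontrivial multiplicity. -/
lemma multiplicity_le_finrank [MulAction.IsPretransitive G Ω] {m : ℕ}
    (hm : ∀ p : Submodule ℝ (Ω → ℝ), IsNontrivIrredComponent G p → m ≤ finrank ℝ (equivHom G p))
    {v : EuclideanSpace ℝ Ω} (hv : v ≠ 0) (hsum : v ∈ sumZero Ω)
    (E : Submodule ℝ (EuclideanSpace ℝ Ω))
    (hE : ∀ Φ : EuclideanSpace ℝ Ω →ₗ[ℝ] EuclideanSpace ℝ Ω,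
      (∀ (g : G) x, Φ (permIsometry Ω g x) = permIsometry Ω g (Φ x)) → Φ v ∈ E) :
    m ≤ finrank ℝ E := by
  set W : Submodule ℝ (EuclideanSpace ℝ Ω) :=
    Submodule.span ℝ (Set.range fun g : G => permIsometry Ω g v) with hW
  have hvW : v ∈ W := Submodule.subset_span ⟨1, by ext ω; simp⟩
  have hWinv : ∀ (g : G), ∀ x ∈ W, permIsometry Ω g x ∈ W := by
    intro g x hx
    induction hx using Submodule.span_induction with
    | mem x hx =>
      obtain ⟨h, rfl⟩ := hx
      exact Submodule.subset_span ⟨g * h, permIsometry_mul g h v⟩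
    | zero => simp
    | add x y _ _ hx hy => rw [map_add]; exact W.add_mem hx hy
    | smul c x _ hx => rw [map_smul]; exact W.smul_mem c hx
  have hWsum : W ≤ sumZero Ω := Submodule.span_le.2 (by
    rintro _ ⟨g, rfl⟩
    exact permIsometry_mem_sumZero g hsum)
  obtain ⟨p, hpW, hp0, hp, hmin⟩ :=
    exists_minimal_invariant_le (fun h => hv (by simpa [h] using hvW)) hWinv
  have hPv : p.starProjection v ≠ 0 := by
    intro h
    rw [Submodule.starProjection_apply_eq_zero_iff] at h
    have hWp : W ≤ pᗮ := Submodule.span_le.2 (by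
      rintro _ ⟨g, rfl⟩
      exact permIsometry_mem_orthogonal hp g h)
    refine hp0 (le_bot_iff.1 ?_)
    rw [← p.inf_orthogonal_eq_bot]
    exact le_inf le_rfl (hpW.trans hWp)
  let e := WithLp.linearEquiv 2 ℝ (Ω → ℝ)
  let p' : Submodule ℝ (Ω → ℝ) := p.comap e.symm.toLinearMap
  have hp' : IsNontrivIrredComponent G p' := by
    refine ⟨fun g x hx => hp g _ hx, ?_, ?_, ?_⟩
    · intro h
      refine hPv ?_
      have : e (p.starProjection v) ∈ p' := p.starProjection_apply_mem v
      simpa [h] using this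
    · intro q hq hqinv
      rcases hmin (q.comap e.toLinearMap) (fun x hx => hq hx) (fun g x hx => hqinv g _ hx)
        with h | h
      · left
        rw [eq_bot_iff]
        intro x hx
        have : e.symm x ∈ q.comap e.toLinearMap := hx
        simpa [h] using this
      · right
        ext x
        exact SetLike.ext_iff.1 h (e.symm x)
    · by_contra! h
      refine hPv (eq_zero_of_forall_permIsometry_eq (G := G) (fun g => ?_)
        (hWsum (hpW (p.starProjection_apply_mem v))))
      exact e.injective (h g (e (p.starProjection v)) (p.starProjection_apply_mem v))
  let P : EuclideanSpace ℝ Ω →ₗ[ℝ] p' :=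
    (e.toLinearMap ∘ₗ p.starProjection.toLinearMap).codRestrict p'
      (fun x => p.starProjection_apply_mem x)
  let ev : equivHom G p' →ₗ[ℝ] E :=
    { toFun := fun φ => ⟨e.symm (φ.1 (P v)), hE (e.symm.toLinearMap ∘ₗ φ.1 ∘ₗ P) (by
        intro g x
        ext ω
        refine φ.2 g (P x) (P (permIsometry Ω g x)) ?_ ω
        change e (p.starProjection _) = _
        rw [starProjection_permIsometry hp]
        rfl)⟩
      map_add' := fun φ ψ => by ext; simp
      map_smul' := fun c φ => by ext; simp }
  refine (hm p' hp').trans (LinearMap.finrank_le_finrank_of_injective (f := ev) ?_)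
  rw [injective_iff_map_eq_zero]
  intro φ hφ
  have hφv : φ.1 (P v) = 0 := by
    have : e.symm (φ.1 (P v)) = 0 := congrArg Subtype.val hφ
    simpa using this
  have hker := hp'.2.2.1 ((LinearMap.ker φ.1).map p'.subtype) (Submodule.map_subtype_le _ _) (by
    rintro g _ ⟨x, hx, rfl⟩
    refine ⟨⟨_, hp'.1 g x x.2⟩, ?_, rfl⟩
    ext ω
    have := φ.2 g x ⟨_, hp'.1 g x x.2⟩ rfl ω
    rw [LinearMap.mem_ker.1 hx] at this
    exact this)
  have hmem : (P v : Ω → ℝ) ∈ (LinearMap.ker φ.1).map p'.subtype := ⟨P v, hφv, rfl⟩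
  rcases hker with h | h
  · rw [h, Submodule.mem_bot] at hmem
    exact absurd (e.map_eq_zero_iff.1 hmem) hPv
  · ext x : 2
    have hx : (x : Ω → ℝ) ∈ (LinearMap.ker φ.1).map p'.subtype := h.ge x.2
    obtain ⟨y, hy, hyx⟩ := hx
    rw [← Subtype.ext hyx]
    exact hy

lemma finrank_equivHom_pos {p : Submodule ℝ (Ω → ℝ)} (hp : p ≠ ⊥) :
    0 < finrank ℝ (equivHom G p) := by
  have hsub : p.subtype ∈ equivHom G p := fun g x y h ω => congrFun h ω
  obtain ⟨x, hx, hx0⟩ := p.exists_mem_ne_zero_of_ne_bot hp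
  have : Nontrivial (equivHom G p) :=
    ⟨⟨_, hsub⟩, 0, fun h => hx0 (LinearMap.congr_fun (congrArg Subtype.val h) ⟨x, hx⟩)⟩
  exact Module.finrank_pos (R := ℝ) (M := equivHom G p)

/-- The operator `x ↦ χ_S ∗ x` on `ℝ^Ω`. -/
noncomputable def convOperator (Ω : Type*) [Fintype Ω] [MulAction G Ω] (S : Finset G) :
    EuclideanSpace ℝ Ω →ₗ[ℝ] EuclideanSpace ℝ Ω :=
  ∑ g ∈ S, (permIsometry Ω g).toLinearEquiv.toLinearMap

/-- The adjoint of `convOperator Ω S`. -/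
noncomputable def convOperatorAdjoint (Ω : Type*) [Fintype Ω] [MulAction G Ω] (S : Finset G) :
    EuclideanSpace ℝ Ω →ₗ[ℝ] EuclideanSpace ℝ Ω :=
  ∑ g ∈ S, (permIsometry Ω g⁻¹).toLinearEquiv.toLinearMap

lemma convOperator_apply (S : Finset G) (x : EuclideanSpace ℝ Ω) :
    convOperator Ω S x = ∑ g ∈ S, permIsometry Ω g x := by
  simp [convOperator]

lemma convOperatorAdjoint_apply (S : Finset G) (x : EuclideanSpace ℝ Ω) :
    convOperatorAdjoint Ω S x = ∑ g ∈ S, permIsometry Ω g⁻¹ x := by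
  simp [convOperatorAdjoint]

lemma inner_convOperator (S : Finset G) (x y : EuclideanSpace ℝ Ω) :
    inner ℝ (convOperator Ω S x) y = inner ℝ x (convOperatorAdjoint Ω S y) := by
  simp only [convOperator_apply, convOperatorAdjoint_apply, sum_inner, inner_sum,
    inner_permIsometry]

lemma inner_convOperatorAdjoint (S : Finset G) (x y : EuclideanSpace ℝ Ω) :
    inner ℝ (convOperatorAdjoint Ω S x) y = inner ℝ x (convOperator Ω S y) := by
  rw [real_inner_comm, ← inner_convOperator, real_inner_comm]

lemma convOperator_mem_sumZero (S : Finset G) {x : EuclideanSpace ℝ Ω} (hx : x ∈ sumZero Ω) :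
    convOperator Ω S x ∈ sumZero Ω := by
  rw [convOperator_apply]
  exact Submodule.sum_mem _ fun g _ => permIsometry_mem_sumZero g hx

lemma convOperatorAdjoint_mem_sumZero (S : Finset G) {x : EuclideanSpace ℝ Ω}
    (hx : x ∈ sumZero Ω) : convOperatorAdjoint Ω S x ∈ sumZero Ω := by
  rw [convOperatorAdjoint_apply]
  exact Submodule.sum_mem _ fun g _ => permIsometry_mem_sumZero g⁻¹ hx

lemma norm_convOperatorAdjoint_single_sq_le [DecidableEq Ω] {S : Finset G} {ℓ : ℕ}
    (hℓ : ∀ ω ω' : Ω, (S.filter fun g => g • ω' = ω).card ≤ ℓ) (ω : Ω) :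
    ‖convOperatorAdjoint Ω S (EuclideanSpace.single ω 1)‖ ^ 2 ≤
      ℓ * ∑ ω' : Ω, ((S.filter fun g => g • ω' = ω).card : ℝ) := by
  rw [EuclideanSpace.real_norm_sq_eq, Finset.mul_sum]
  refine Finset.sum_le_sum fun ω' _ => ?_
  have : convOperatorAdjoint Ω S (EuclideanSpace.single ω 1) ω' =
      ((S.filter fun g => g • ω' = ω).card : ℝ) := by
    simp [convOperatorAdjoint_apply]
  rw [this, sq]
  gcongr
  exact hℓ ω ω'

lemma sum_norm_convOperatorAdjoint_single_sq_le [DecidableEq Ω] {S : Finset G} {ℓ : ℕ}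
    (hℓ : ∀ ω ω' : Ω, (S.filter fun g => g • ω' = ω).card ≤ ℓ) :
    ∑ ω : Ω, ‖convOperatorAdjoint Ω S (EuclideanSpace.single ω 1)‖ ^ 2 ≤
      ℓ * Fintype.card Ω * S.card := by
  refine (Finset.sum_le_sum fun ω _ => norm_convOperatorAdjoint_single_sq_le hℓ ω).trans
    (le_of_eq ?_)
  rw [← Finset.mul_sum, Finset.sum_comm, mul_assoc]
  congr 1
  have h : ∀ ω' : Ω, ∑ ω : Ω, ((S.filter fun g => g • ω' = ω).card : ℝ) = S.card := by
    intro ω'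
    exact_mod_cast (Finset.card_eq_sum_card_fiberwise (f := fun g : G => g • ω')
      (t := Finset.univ) (by simp)).symm
  simp [h]

/-- The Hilbert–Schmidt norm of `convOperator Ω S` bounds the dimension of any subspace on which
the operator scales squared norms by `c`. -/
lemma finrank_mul_le {S : Finset G} {ℓ : ℕ}
    (hℓ : ∀ ω ω' : Ω, {g : G | g ∈ S ∧ g • ω' = ω}.ncard ≤ ℓ)
    (E : Submodule ℝ (EuclideanSpace ℝ Ω)) {c : ℝ}
    (hE : ∀ x ∈ E, ‖convOperator Ω S x‖ ^ 2 = c * ‖x‖ ^ 2) :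
    finrank ℝ E * c ≤ ℓ * Fintype.card Ω * S.card := by
  classical
  have hcard : ∀ ω ω' : Ω, (S.filter fun g => g • ω' = ω).card ≤ ℓ := by
    intro ω ω'
    rw [← Set.ncard_coe_finset]
    simpa using hℓ ω ω'
  let b := stdOrthonormalBasis ℝ E
  have hb : Orthonormal ℝ fun i => (b i : EuclideanSpace ℝ Ω) :=
    b.orthonormal.comp_linearIsometry E.subtypeₗᵢ
  calc (finrank ℝ E : ℝ) * c = ∑ i, ‖convOperator Ω S (b i)‖ ^ 2 := by
        have h : ∀ i, ‖convOperator Ω S (b i)‖ ^ 2 = c := fun i => by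
          have hi : ‖(b i : EuclideanSpace ℝ Ω)‖ = 1 := b.norm_eq_one i
          rw [hE _ (b i).2, hi, one_pow, mul_one]
        simp [h]
    _ = ∑ i, ∑ ω, ‖inner ℝ (b i : EuclideanSpace ℝ Ω)
          (convOperatorAdjoint Ω S (EuclideanSpace.single ω 1))‖ ^ 2 := by
        simp only [← inner_convOperator, EuclideanSpace.norm_sq_eq,
          EuclideanSpace.inner_single_right]
        simp
    _ = ∑ ω, ∑ i, ‖inner ℝ (b i : EuclideanSpace ℝ Ω)
          (convOperatorAdjoint Ω S (EuclideanSpace.single ω 1))‖ ^ 2 := Finset.sum_comm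
    _ ≤ ∑ ω, ‖convOperatorAdjoint Ω S (EuclideanSpace.single ω 1)‖ ^ 2 :=
        Finset.sum_le_sum fun ω _ => hb.sum_inner_products_le _
    _ ≤ _ := sum_norm_convOperatorAdjoint_single_sq_le hcard

/-- A symmetric operator on a finite-dimensional space, all of whose eigenvalues are at most `c`,
has quadratic form at most `c‖x‖²`. -/
lemma LinearMap.IsSymmetric.inner_apply_le {V : Type*} [NormedAddCommGroup V]
    [InnerProductSpace ℝ V] [FiniteDimensional ℝ V] {A : V →ₗ[ℝ] V} (hA : A.IsSymmetric) {c : ℝ}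
    (hc : ∀ (μ : ℝ) (v : V), v ≠ 0 → A v = μ • v → μ ≤ c) (x : V) :
    inner ℝ (A x) x ≤ c * ‖x‖ ^ 2 := by
  let b := hA.eigenvectorBasis rfl
  have hμ : ∀ i, hA.eigenvalues rfl i ≤ c := fun i =>
    hc _ (b i) (b.orthonormal.ne_zero i) (hA.apply_eigenvectorBasis rfl i)
  rw [← b.sum_inner_mul_inner, ← b.sum_sq_norm_inner_right x, Finset.mul_sum]
  refine Finset.sum_le_sum fun i _ => ?_
  have h : inner ℝ (A x) (b i) = hA.eigenvalues rfl i * inner ℝ (b i) x := by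
    rw [hA, hA.apply_eigenvectorBasis rfl i, inner_smul_right, real_inner_comm]
    rfl
  rw [h, Real.norm_eq_abs, sq_abs, mul_assoc, ← sq]
  exact mul_le_mul_of_nonneg_right (hμ i) (sq_nonneg _)

/-- Squared form of the convolution bound, for vectors with coordinate sum zero. -/
lemma norm_convOperator_sq_le [MulAction.IsPretransitive G Ω] {m : ℕ} (hm0 : 0 < m)
    (hm : ∀ p : Submodule ℝ (Ω → ℝ), IsNontrivIrredComponent G p → m ≤ finrank ℝ (equivHom G p))
    {S : Finset G} {ℓ : ℕ} (hℓ : ∀ ω ω' : Ω, {g : G | g ∈ S ∧ g • ω' = ω}.ncard ≤ ℓ)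
    {x : EuclideanSpace ℝ Ω} (hx : x ∈ sumZero Ω) :
    ‖convOperator Ω S x‖ ^ 2 ≤ ℓ * Fintype.card Ω / m * S.card * ‖x‖ ^ 2 := by
  set A : EuclideanSpace ℝ Ω →ₗ[ℝ] EuclideanSpace ℝ Ω :=
    convOperatorAdjoint Ω S ∘ₗ convOperator Ω S with hA
  have hinner : ∀ y z, inner ℝ (A y) z = inner ℝ (convOperator Ω S y) (convOperator Ω S z) :=
    fun y z => inner_convOperatorAdjoint S _ _
  have hAsymm : A.IsSymmetric := fun y z => by
    rw [hinner, real_inner_comm, ← hinner, real_inner_comm]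
  have hAZ : ∀ y ∈ sumZero Ω, A y ∈ sumZero Ω := fun y hy =>
    convOperatorAdjoint_mem_sumZero S (convOperator_mem_sumZero S hy)
  have key := (hAsymm.restrict_invariant hAZ).inner_apply_le
    (c := ℓ * Fintype.card Ω / m * S.card) ?_ ⟨x, hx⟩
  · rw [← real_inner_self_eq_norm_sq, ← hinner]
    exact key
  intro μ v hv hAv
  have hv0 : (v : EuclideanSpace ℝ Ω) ≠ 0 := fun h => hv (Subtype.ext h)
  have hAv' : A v = μ • (v : EuclideanSpace ℝ Ω) := congrArg Subtype.val hAv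
  have hEnorm : ∀ y ∈ Module.End.eigenspace A μ,
      ‖convOperator Ω S y‖ ^ 2 = μ * ‖y‖ ^ 2 := by
    intro y hy
    rw [← real_inner_self_eq_norm_sq, ← hinner, Module.End.mem_eigenspace_iff.1 hy,
      inner_smul_left, real_inner_self_eq_norm_sq]
    rfl
  have hμ : 0 ≤ μ := by
    have h := hEnorm v (Module.End.mem_eigenspace_iff.2 hAv')
    have hpos : 0 < ‖(v : EuclideanSpace ℝ Ω)‖ ^ 2 := by positivity
    exact nonneg_of_mul_nonneg_left (h ▸ sq_nonneg _) hpos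
  have hle := multiplicity_le_finrank hm hv0 v.2 (Module.End.eigenspace A μ) (by
    intro Φ hΦ
    rw [Module.End.mem_eigenspace_iff, ← map_smul, ← hAv']
    simp only [hA, LinearMap.comp_apply, convOperator_apply, convOperatorAdjoint_apply, map_sum,
      hΦ])
  have h := finrank_mul_le hℓ (Module.End.eigenspace A μ) hEnorm
  have h' : (m : ℝ) * μ ≤ ℓ * Fintype.card Ω * S.card :=
    (mul_le_mul_of_nonneg_right (by exact_mod_cast hle) hμ).trans h
  rw [div_mul_eq_mul_div, le_div_iff₀ (by exact_mod_cast hm0), mul_comm μ]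
  exact h'

lemma norm2_eq_norm (f : Ω → ℝ) : norm2 f = ‖WithLp.toLp 2 f‖ := by
  simp [norm2, EuclideanSpace.norm_eq]

end

/-- Gowers-type convolution bound: `‖χ_S ∗ f‖ ≤ √(ℓ_S |Ω| / m_H) · ‖χ_S‖ · ‖f‖`,
where `m_H` is the minimal multiplicity of a nontrivial irreducible component of the
permutation representation and `ℓ_S = max_{g₁,g₂} |g₁ H g₂ ∩ S|` with `H` a point
stabilizer. -/
theorem convolution_bound_mH
    {G : Type*} [Group G] [Fintype G] [DecidableEq G] {Ω : Type*} [Fintype Ω]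
    [MulAction G Ω] [MulAction.IsPretransitive G Ω]
    (m : ℕ)
    (hm : IsLeast {k : ℕ | ∃ p : Submodule ℝ (Ω → ℝ),
      IsNontrivIrredComponent G p ∧ k = Module.finrank ℝ (equivHom G p)} m)
    (ω₀ : Ω) (S : Finset G) (ℓ : ℕ)
    (hℓ : IsGreatest {k : ℕ | ∃ g₁ g₂ : G,
      k = Set.ncard {x : G | x ∈ S ∧ g₁⁻¹ * x * g₂⁻¹ ∈ MulAction.stabilizer G ω₀}} ℓ)
    (f : Ω → ℝ) (hf : ∑ ω : Ω, f ω = 0) :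
    norm2 (convAct (fun g => if g ∈ S then (1 : ℝ) else 0) f) ≤
      Real.sqrt ((ℓ : ℝ) * (Fintype.card Ω : ℝ) / (m : ℝ)) *
        norm2 (fun g => if g ∈ S then (1 : ℝ) else 0) * norm2 f := by
  have hm0 : 0 < m := by
    obtain ⟨p, hp, rfl⟩ := hm.1
    exact finrank_equivHom_pos hp.2.1
  have hcard : ∀ ω ω' : Ω, {g : G | g ∈ S ∧ g • ω' = ω}.ncard ≤ ℓ := by
    intro ω ω'
    obtain ⟨g₁, rfl⟩ := MulAction.exists_smul_eq G ω₀ ω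
    obtain ⟨g₂, rfl⟩ := MulAction.exists_smul_eq G ω' ω₀
    refine hℓ.2 ⟨g₁, g₂, ?_⟩
    congr 1
    ext x
    simp [MulAction.mem_stabilizer_iff, mul_smul, inv_smul_eq_iff]
  have hconv : convAct (fun g => if g ∈ S then (1 : ℝ) else 0) f =
      (convOperator Ω S (WithLp.toLp 2 f)).ofLp := by
    ext ω
    simp [convAct, convOperator_apply]
  have hS : norm2 (fun g => if g ∈ S then (1 : ℝ) else 0) = Real.sqrt S.card := by
    simp [norm2]
  rw [hconv, hS, norm2_eq_norm, norm2_eq_norm, ← Real.sqrt_mul (by positivity)]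
  refine le_of_sq_le_sq ?_ (by positivity)
  rw [mul_pow, Real.sq_sqrt (by positivity)]
  exact norm_convOperator_sq_le hm0 (fun p hp => hm.2 ⟨p, hp, rfl⟩) hcard hf
end

section
/- Let G be a finite group acting transitively on a finite set Ω with point stabilizer H, and let d_H be the minimum degree of a nontrivial irreducible component of the permutation representation. For any S ⊆ G and Γ ⊆ Ω, |S(Γ)| > |Ω| / (1 + |G||Ω|/(d_H|S||Γ|)), and consequently |S(Γ)| ≥ min{|Ω|/2, d_H|S||Γ|/(2|G|)}. -/
open scoped BigOperators

theorem exists_frame_eigenvector {ι E : Type*} [Fintype ι] [NormedAddCommGroup E]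
    [InnerProductSpace ℝ E] [FiniteDimensional ℝ E] [Nontrivial E] (v : ι → E) :
    ∃ (c : ℝ) (x : E), 0 ≤ c ∧ x ≠ 0 ∧ ∑ i, inner ℝ (v i) x • v i = c • x ∧
      ∀ y, ∑ i, inner ℝ (v i) y ^ 2 ≤ c * ‖y‖ ^ 2 := by
  let T : E →ₗ[ℝ] E := ∑ i, (innerₛₗ ℝ (v i)).smulRight (v i)
  have hT : ∀ y, T y = ∑ i, inner ℝ (v i) y • v i := fun y => by
    simp [T, LinearMap.sum_apply]
  have hq : ∀ y, inner ℝ (T y) y = ∑ i, inner ℝ (v i) y ^ 2 := fun y => by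
    simp only [hT, sum_inner, inner_smul_left, pow_two]
    rfl
  have hsymm : T.IsSymmetric := fun y z => by
    simp only [hT, sum_inner, inner_sum, inner_smul_left, inner_smul_right]
    refine Finset.sum_congr rfl fun i _ => ?_
    rw [real_inner_comm y]
    simp [mul_comm]
  have hev := hsymm.hasEigenvalue_iSup_of_finiteDimensional
  obtain ⟨x, hx⟩ := hev.exists_hasEigenvector
  set c := ⨆ x : { x : E // x ≠ 0 }, RCLike.re (inner ℝ (T x) (x : E)) / ‖(x : E)‖ ^ 2 with hc
  have hbdd : BddAbove (Set.range fun x : { x : E // x ≠ 0 } =>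
      RCLike.re (inner ℝ (T x) (x : E)) / ‖(x : E)‖ ^ 2) := by
    refine ⟨∑ i, ‖v i‖ ^ 2, ?_⟩
    rintro _ ⟨⟨y, hy⟩, rfl⟩
    have hy' : 0 < ‖y‖ ^ 2 := by positivity
    simp only [hq, RCLike.re_to_real]
    rw [div_le_iff₀ hy', Finset.sum_mul]
    refine Finset.sum_le_sum fun i _ => ?_
    rw [← mul_pow, sq_le_sq, abs_of_nonneg (by positivity : 0 ≤ ‖v i‖ * ‖y‖)]
    exact abs_real_inner_le_norm _ _
  have hle : ∀ y, ∑ i, inner ℝ (v i) y ^ 2 ≤ c * ‖y‖ ^ 2 := fun y => by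
    rcases eq_or_ne y 0 with rfl | hy
    · simp
    · have := le_ciSup hbdd ⟨y, hy⟩
      simp only [hq, RCLike.re_to_real] at this
      rw [div_le_iff₀ (by positivity)] at this
      simpa only [hc, hq, RCLike.re_to_real] using this
  have hc0 : 0 ≤ c := by
    have hx0 : 0 < ‖x‖ ^ 2 := by have := hx.2; positivity
    have h := (Finset.sum_nonneg fun i _ => sq_nonneg (inner ℝ (v i) x)).trans (hle x)
    exact nonneg_of_mul_nonneg_left h hx0
  exact ⟨c, x, hc0, hx.2, by rw [← hT]; exact hx.apply_eq_smul, hle⟩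

theorem eigenvalue_mul_finrank_le_sum {ι E : Type*} [Fintype ι] [NormedAddCommGroup E]
    [InnerProductSpace ℝ E] [FiniteDimensional ℝ E] (v : ι → E) (c : ℝ) (q : Submodule ℝ E)
    (hq : ∀ x ∈ q, ∑ i, inner ℝ (v i) x • v i = c • x) :
    c * Module.finrank ℝ q ≤ ∑ i, ‖v i‖ ^ 2 := by
  let e := stdOrthonormalBasis ℝ q
  have he : Orthonormal ℝ fun j => (e j : E) :=
    e.orthonormal.comp_linearIsometry q.subtypeₗᵢ
  calc c * Module.finrank ℝ q = ∑ _j : Fin (Module.finrank ℝ q), c := by simp [mul_comm]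
    _ = ∑ j, ∑ i, inner ℝ (e j : E) (v i) ^ 2 := by
        refine Finset.sum_congr rfl fun j _ => ?_
        have h := congrArg (inner ℝ (e j : E)) (hq (e j) (e j).2)
        rw [inner_smul_right, real_inner_self_eq_norm_sq, he.1 j, inner_sum] at h
        simp only [inner_smul_right] at h
        rw [one_pow, mul_one] at h
        rw [← h]
        refine Finset.sum_congr rfl fun i _ => ?_
        rw [real_inner_comm, pow_two]
    _ = ∑ i, ∑ j, inner ℝ (e j : E) (v i) ^ 2 := Finset.sum_comm
    _ ≤ ∑ i, ‖v i‖ ^ 2 := Finset.sum_le_sum fun i _ => by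
        simpa using he.sum_inner_products_le (s := Finset.univ) (v i)

theorem norm_sq_sum_le {ι E : Type*} [Fintype ι] [NormedAddCommGroup E]
    [InnerProductSpace ℝ E] (v : ι → E) (c : ℝ) (hc0 : 0 ≤ c)
    (hc : ∀ y, ∑ i, inner ℝ (v i) y ^ 2 ≤ c * ‖y‖ ^ 2) (S : Finset ι) :
    ‖∑ s ∈ S, v s‖ ^ 2 ≤ c * S.card := by
  set y := ∑ s ∈ S, v s with hy
  have h1 : ‖y‖ ^ 2 = ∑ s ∈ S, inner ℝ (v s) y := by
    rw [← sum_inner, ← hy, real_inner_self_eq_norm_sq]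
  have h2 : (‖y‖ ^ 2) ^ 2 ≤ S.card * (c * ‖y‖ ^ 2) := by
    calc (‖y‖ ^ 2) ^ 2 ≤ S.card * ∑ s ∈ S, inner ℝ (v s) y ^ 2 := by
          rw [h1]; exact sq_sum_le_card_mul_sum_sq
      _ ≤ _ := by
          gcongr
          exact (Finset.sum_le_univ_sum_of_nonneg fun _ => sq_nonneg _).trans (hc y)
  rcases eq_or_ne y 0 with h0 | h0
  · rw [h0]; simp; positivity
  · have : 0 < ‖y‖ ^ 2 := by positivity
    nlinarith

theorem exists_irreducible_le (G : Type*) [Group G] {Ω : Type*} [Finite Ω] [MulAction G Ω]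
    (q : Submodule ℝ (Ω → ℝ)) (hq : PermInvariant G q) (hq0 : q ≠ ⊥) :
    ∃ p ≤ q, PermInvariant G p ∧ p ≠ ⊥ ∧
      ∀ r : Submodule ℝ (Ω → ℝ), r ≤ p → PermInvariant G r → r = ⊥ ∨ r = p := by
  obtain ⟨p, ⟨hpq, hp, hp0⟩, hmin⟩ := wellFounded_lt.has_min
    {p : Submodule ℝ (Ω → ℝ) | p ≤ q ∧ PermInvariant G p ∧ p ≠ ⊥} ⟨q, le_rfl, hq, hq0⟩
  refine ⟨p, hpq, hp, hp0, fun r hrp hr => or_iff_not_imp_left.2 fun hr0 => ?_⟩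
  exact hrp.eq_or_lt.resolve_right (hmin r ⟨hrp.trans hpq, hr, hr0⟩)

/-- The translate by `g` of a function, as a vector of the Euclidean space on `Ω`. -/
def permTranslate {G : Type*} [Group G] {Ω : Type*} [MulAction G Ω] (u : Ω → ℝ) (g : G) :
    EuclideanSpace ℝ Ω :=
  WithLp.toLp 2 fun ω => u (g⁻¹ • ω)

section Translate

variable {G : Type*} [Group G] {Ω : Type*} [MulAction G Ω]

@[simp]
theorem permTranslate_apply (u : Ω → ℝ) (g : G) (ω : Ω) : permTranslate u g ω = u (g⁻¹ • ω) := rfl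

variable [Fintype Ω]

theorem inner_permTranslate_mul (u f : Ω → ℝ) (g k : G) :
    inner ℝ (permTranslate u (g * k)) (permTranslate f g) =
      inner ℝ (permTranslate u k) (WithLp.toLp 2 f) := by
  simp only [PiLp.inner_apply, permTranslate_apply, mul_inv_rev, mul_smul]
  exact Equiv.sum_comp (MulAction.toPerm g⁻¹) fun ω => inner ℝ (u (k⁻¹ • ω)) (f ω)

theorem norm_sq_permTranslate (u : Ω → ℝ) (g : G) : ‖permTranslate u g‖ ^ 2 = ∑ ω, u ω ^ 2 := by
  rw [EuclideanSpace.real_norm_sq_eq]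
  exact Equiv.sum_comp (MulAction.toPerm g⁻¹) fun ω => u ω ^ 2

theorem inner_permTranslate_eq_zero_of_fixed [MulAction.IsPretransitive G Ω] {u f : Ω → ℝ}
    (hu : ∑ ω, u ω = 0) (hf : ∀ g : G, (fun ω => f (g⁻¹ • ω)) = f) (k : G) :
    inner ℝ (permTranslate u k) (WithLp.toLp 2 f) = 0 := by
  rcases isEmpty_or_nonempty Ω with h | ⟨⟨o⟩⟩
  · simp [PiLp.inner_apply]
  have hconst : ∀ ω, f ω = f o := fun ω => by
    obtain ⟨g, rfl⟩ := MulAction.exists_smul_eq G ω o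
    simpa using congrFun (hf g) (g • ω)
  have hsum : ∑ ω, u (k⁻¹ • ω) = 0 := by
    rw [← hu]; exact Equiv.sum_comp (MulAction.toPerm k⁻¹) u
  simp only [PiLp.inner_apply, permTranslate_apply, hconst]
  simp [← Finset.mul_sum, hsum]

/-- The bound on the top eigenvalue of the frame of translates of a mean-zero function, coming
from the multiplicity of the eigenvalue. -/
theorem exists_frame_bound_permTranslate [Fintype G] [MulAction.IsPretransitive G Ω] [Nonempty Ω]
    {d : ℕ} (hd : ∀ p : Submodule ℝ (Ω → ℝ), IsNontrivIrredComponent G p →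
      d ≤ Module.finrank ℝ p) {u : Ω → ℝ} (hu : ∑ ω, u ω = 0) :
    ∃ c : ℝ, 0 ≤ c ∧ c * d ≤ Fintype.card G * ∑ ω, u ω ^ 2 ∧
      ∀ y, ∑ g : G, inner ℝ (permTranslate u g) y ^ 2 ≤ c * ‖y‖ ^ 2 := by
  obtain ⟨c, x, hc0, hx0, hx, hc⟩ := exists_frame_eigenvector (permTranslate (G := G) u)
  refine ⟨c, hc0, ?_, hc⟩
  rcases hc0.eq_or_lt with rfl | hcpos
  · rw [zero_mul]; positivity
  let q : Submodule ℝ (Ω → ℝ) :=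
    { carrier := {f | ∑ g : G, inner ℝ (permTranslate u g) (WithLp.toLp 2 f) • permTranslate u g =
        c • WithLp.toLp 2 f}
      add_mem' := fun {f f'} hf hf' => by
        simp only [Set.mem_ofPred_eq] at *
        simp [inner_add_right, add_smul, Finset.sum_add_distrib, hf, hf']
      zero_mem' := by simp
      smul_mem' := fun a f hf => by
        simp only [Set.mem_ofPred_eq] at *
        simp only [WithLp.toLp_smul, inner_smul_right, mul_smul, ← Finset.smul_sum, hf]
        rw [smul_comm] }
  have hqinv : PermInvariant G q := fun g f hf => by
    change ∑ k : G, inner ℝ (permTranslate u k) (permTranslate f g) • permTranslate u k = c • permTranslate f g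
    rw [← Equiv.sum_comp (Equiv.mulLeft g)]
    ext ω
    have h := congrArg (fun y : EuclideanSpace ℝ Ω => y (g⁻¹ • ω)) hf
    simp only [Equiv.coe_mulLeft, inner_permTranslate_mul]
    simpa [mul_smul] using h
  have hq0 : q ≠ ⊥ := fun h => hx0 <| by
    have hxq : (WithLp.ofLp x) ∈ q := hx
    rw [h, Submodule.mem_bot] at hxq
    exact (WithLp.ofLp_injective 2) hxq
  obtain ⟨p, hpq, hp, hp0, hirr⟩ := exists_irreducible_le G q hqinv hq0
  have hnontriv : ∃ (g : G) (f : Ω → ℝ), f ∈ p ∧ (fun ω => f (g⁻¹ • ω)) ≠ f := by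
    by_contra! hfix
    refine hp0 ((Submodule.eq_bot_iff p).2 fun f hf => ?_)
    have hfq : ∑ g : G, inner ℝ (permTranslate u g) (WithLp.toLp 2 f) • permTranslate u g =
        c • WithLp.toLp 2 f := hpq hf
    simp only [inner_permTranslate_eq_zero_of_fixed hu fun g => hfix g f hf, zero_smul,
      Finset.sum_const_zero] at hfq
    exact (WithLp.toLp_injective 2) ((smul_eq_zero.1 hfq.symm).resolve_left hcpos.ne')
  let p' : Submodule ℝ (EuclideanSpace ℝ Ω) :=
    p.map (WithLp.linearEquiv 2 ℝ (Ω → ℝ)).symm.toLinearMap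
  have hrank : Module.finrank ℝ p' = Module.finrank ℝ p := LinearEquiv.finrank_map_eq _ _
  have hle := eigenvalue_mul_finrank_le_sum (permTranslate (G := G) u) c p' (by
    rintro _ ⟨f, hf, rfl⟩
    exact hpq hf)
  calc c * d ≤ c * Module.finrank ℝ p' := by
        rw [hrank]
        gcongr
        exact hd p ⟨hp, hp0, hirr, hnontriv⟩
    _ ≤ ∑ g : G, ‖permTranslate u g‖ ^ 2 := hle
    _ = Fintype.card G * ∑ ω, u ω ^ 2 := by simp [norm_sq_permTranslate]

end Translate

theorem sum_indicator_smul {G : Type*} [Group G] {Ω : Type*} [Fintype Ω] [DecidableEq Ω]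
    [MulAction G Ω] (Γ : Finset Ω) (g : G) :
    ∑ ω, (if g⁻¹ • ω ∈ Γ then 1 else 0 : ℝ) = Γ.card := by
  have h := Equiv.sum_comp (MulAction.toPerm (α := G) (β := Ω) g⁻¹)
    fun ω => (if ω ∈ Γ then 1 else 0 : ℝ)
  simpa using h

/-- Cauchy-Schwarz for the function counting representations of `ω` in `S(Γ)`. -/
theorem sq_card_mul_card_le {G : Type*} [Group G] {Ω : Type*} [Fintype Ω] [DecidableEq Ω]
    [MulAction G Ω] (S : Finset G) (Γ : Finset Ω) :
    ((S.card : ℝ) * Γ.card) ^ 2 ≤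
      ((Finset.image₂ (fun (s : G) (γ : Ω) => s • γ) S Γ).card : ℝ) *
        ∑ ω, (∑ s ∈ S, (if s⁻¹ • ω ∈ Γ then 1 else 0 : ℝ)) ^ 2 := by
  set Δ := Finset.image₂ (fun (s : G) (γ : Ω) => s • γ) S Γ
  set F : Ω → ℝ := fun ω => ∑ s ∈ S, (if s⁻¹ • ω ∈ Γ then 1 else 0 : ℝ)
  have hzero : ∀ ω ∈ Finset.univ, ω ∉ Δ → F ω = 0 := fun ω _ hω => by
    refine Finset.sum_eq_zero fun s hs => if_neg fun h => hω ?_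
    exact Finset.mem_image₂.2 ⟨s, hs, _, h, smul_inv_smul s ω⟩
  have htotal : ∑ ω ∈ Δ, F ω = S.card * Γ.card := by
    rw [Finset.sum_subset (Finset.subset_univ Δ) hzero, Finset.sum_comm]
    simp only [sum_indicator_smul, Finset.sum_const, nsmul_eq_mul]
  rw [← htotal]
  refine sq_sum_le_card_mul_sum_sq.trans ?_
  exact mul_le_mul_of_nonneg_left
    (Finset.sum_le_univ_sum_of_nonneg fun ω => sq_nonneg (F ω)) (Nat.cast_nonneg _)

theorem sum_sub_mean_sq {Ω : Type*} [Fintype Ω] [Nonempty Ω] (f : Ω → ℝ) {m : ℝ}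
    (hm : ∑ ω, f ω = m) :
    ∑ ω, (f ω - m / Fintype.card Ω) ^ 2 = ∑ ω, f ω ^ 2 - m ^ 2 / Fintype.card Ω := by
  have hn : (Fintype.card Ω : ℝ) ≠ 0 := by simp
  simp only [sub_sq, Finset.sum_add_distrib, Finset.sum_sub_distrib, ← Finset.sum_mul,
    ← Finset.mul_sum, hm, Finset.sum_const, Finset.card_univ, nsmul_eq_mul]
  field_simp
  ring

/-- The growth bound with denominators cleared. -/
theorem card_mul_lt_card_image_mul {G : Type*} [Group G] [Fintype G] {Ω : Type*} [Fintype Ω]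
    [DecidableEq Ω] [MulAction G Ω] [MulAction.IsPretransitive G Ω] {d : ℕ}
    (hd : ∀ p : Submodule ℝ (Ω → ℝ), IsNontrivIrredComponent G p →
      d ≤ Module.finrank ℝ p)
    {S : Finset G} {Γ : Finset Ω} (hS : S.Nonempty) (hΓ : Γ.Nonempty) :
    (Fintype.card Ω : ℝ) * (d * S.card * Γ.card) <
      ((Finset.image₂ (fun (s : G) (γ : Ω) => s • γ) S Γ).card : ℝ) *
        (d * S.card * Γ.card + Fintype.card G * Fintype.card Ω) := by
  have : Nonempty Ω := ⟨hΓ.choose⟩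
  have hCS := sq_card_mul_card_le S Γ
  have hD : 0 < ((Finset.image₂ (fun (s : G) (γ : Ω) => s • γ) S Γ).card : ℝ) :=
    Nat.cast_pos.2 (hS.image₂ hΓ).card_pos
  have hs : 0 < (S.card : ℝ) := Nat.cast_pos.2 hS.card_pos
  have ht : 0 < (Γ.card : ℝ) := Nat.cast_pos.2 hΓ.card_pos
  have hn : 0 < (Fintype.card Ω : ℝ) := Nat.cast_pos.2 Fintype.card_pos
  have hN : 0 < (Fintype.card G : ℝ) := Nat.cast_pos.2 Fintype.card_pos
  set D : ℝ := ((Finset.image₂ (fun (s : G) (γ : Ω) => s • γ) S Γ).card : ℝ)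
  set u : Ω → ℝ := fun ω => (if ω ∈ Γ then 1 else 0) - Γ.card / Fintype.card Ω with hu
  have hmean : ∑ ω, (if ω ∈ Γ then 1 else 0 : ℝ) = Γ.card := by simp
  have hu0 : ∑ ω, u ω = 0 := by
    simp only [hu, Finset.sum_sub_distrib, hmean, Finset.sum_const, Finset.card_univ,
      nsmul_eq_mul]
    field_simp
    simp
  have hu2 : ∑ ω, u ω ^ 2 < Γ.card := by
    rw [hu, sum_sub_mean_sq _ hmean]
    have : 0 < (Γ.card : ℝ) ^ 2 / Fintype.card Ω := by positivity
    simpa using this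
  obtain ⟨c, hc0, hcd, hc⟩ := exists_frame_bound_permTranslate hd hu0
  have hnorm := norm_sq_sum_le _ c hc0 hc S
  rw [EuclideanSpace.real_norm_sq_eq] at hnorm
  have hFsum : ∑ ω, ∑ s ∈ S, (if s⁻¹ • ω ∈ Γ then 1 else 0 : ℝ) = S.card * Γ.card := by
    rw [Finset.sum_comm]
    simp only [sum_indicator_smul, Finset.sum_const, nsmul_eq_mul]
  have hF := sum_sub_mean_sq _ hFsum
  have hcoord : ∀ ω, (∑ s ∈ S, permTranslate u s) ω =
      ∑ s ∈ S, (if s⁻¹ • ω ∈ Γ then 1 else 0 : ℝ) -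
        (S.card : ℝ) * Γ.card / Fintype.card Ω := fun ω => by
    simp [hu, mul_div_assoc]
  simp only [hcoord] at hnorm
  rw [hF] at hnorm
  set Q := ∑ ω, (∑ s ∈ S, (if s⁻¹ • ω ∈ Γ then 1 else 0 : ℝ)) ^ 2
  set s : ℝ := (S.card : ℝ)
  set t : ℝ := (Γ.card : ℝ)
  set n : ℝ := (Fintype.card Ω : ℝ)
  set N : ℝ := (Fintype.card G : ℝ)
  have hcd' : c * d < N * t := hcd.trans_lt (by gcongr)
  have hQ : n * Q ≤ n * (c * s) + (s * t) ^ 2 := by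
    have : Q ≤ c * s + (s * t) ^ 2 / n := by linarith
    calc n * Q ≤ n * (c * s + (s * t) ^ 2 / n) := by gcongr
      _ = _ := by field_simp
  refine lt_of_mul_lt_mul_right (a := s * t) ?_ (by positivity)
  calc n * (d * s * t) * (s * t) = n * d * (s * t) ^ 2 := by ring
    _ ≤ n * d * (D * Q) := by gcongr
    _ = D * d * (n * Q) := by ring
    _ ≤ D * d * (n * (c * s) + (s * t) ^ 2) := by gcongr
    _ = D * (n * s * (c * d) + d * (s * t) ^ 2) := by ring
    _ < D * (n * s * (N * t) + d * (s * t) ^ 2) := by gcongr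
    _ = D * (d * s * t + N * n) * (s * t) := by ring

/-- Large sets grow: `|S(Γ)| > |Ω| / (1 + |G||Ω|/(d_H |S||Γ|))`, and consequently
`|S(Γ)| ≥ min{|Ω|/2, d_H |S||Γ|/(2|G|)}`. -/
theorem large_sets_grow
    {G : Type*} [Group G] [Fintype G] {Ω : Type*} [Fintype Ω] [DecidableEq Ω]
    [MulAction G Ω] [MulAction.IsPretransitive G Ω]
    (d : ℕ)
    (hd : IsLeast {k : ℕ | ∃ p : Submodule ℝ (Ω → ℝ),
      IsNontrivIrredComponent G p ∧ k = Module.finrank ℝ p} d)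
    (S : Finset G) (Γ : Finset Ω) (hS : S.Nonempty) (hΓ : Γ.Nonempty) :
    (((Finset.image₂ (fun (s : G) (γ : Ω) => s • γ) S Γ).card : ℝ) >
        (Fintype.card Ω : ℝ) /
          (1 + ((Fintype.card G : ℝ) * (Fintype.card Ω : ℝ)) /
            ((d : ℝ) * (S.card : ℝ) * (Γ.card : ℝ)))) ∧
    (((Finset.image₂ (fun (s : G) (γ : Ω) => s • γ) S Γ).card : ℝ) ≥
        min ((Fintype.card Ω : ℝ) / 2)
          ((d : ℝ) * (S.card : ℝ) * (Γ.card : ℝ) / (2 * (Fintype.card G : ℝ)))) := by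
  have hdpos : 0 < (d : ℝ) := by
    obtain ⟨p, hp, rfl⟩ := hd.1
    have := Submodule.one_le_finrank_iff.2 hp.2.1
    exact_mod_cast this
  have hmain := card_mul_lt_card_image_mul (fun p hp => hd.2 ⟨p, hp, rfl⟩) hS hΓ
  have : Nonempty Ω := ⟨hΓ.choose⟩
  have hs : 0 < (S.card : ℝ) := Nat.cast_pos.2 hS.card_pos
  have ht : 0 < (Γ.card : ℝ) := Nat.cast_pos.2 hΓ.card_pos
  have hn : 0 < (Fintype.card Ω : ℝ) := Nat.cast_pos.2 Fintype.card_pos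
  have hN : 0 < (Fintype.card G : ℝ) := Nat.cast_pos.2 Fintype.card_pos
  set D : ℝ := ((Finset.image₂ (fun (s : G) (γ : Ω) => s • γ) S Γ).card : ℝ)
  set n : ℝ := (Fintype.card Ω : ℝ)
  set N : ℝ := (Fintype.card G : ℝ)
  have hx : 0 < (d : ℝ) * S.card * Γ.card := by positivity
  set x : ℝ := (d : ℝ) * S.card * Γ.card
  constructor
  · rw [gt_iff_lt, div_lt_iff₀ (by positivity)]
    refine lt_of_mul_lt_mul_right (a := x) (hmain.trans_eq ?_) hx.le
    field_simp
  · by_contra! hlt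
    obtain ⟨h1, h2⟩ := lt_min_iff.1 hlt
    rw [lt_div_iff₀ (by positivity)] at h1 h2
    nlinarith
end
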